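/- Structure of the optimum when no sensor interval intersects the barrier (the structural content of Lemma 18 of the paper): assume there is an index k with 1 ≤ k < n such that x_k + z < 0 and β + z < x_{k+1} (so no interval [x_i − z, x_i + z] intersects [0, β]), and assume λ := ⌈β/(2z)⌉ ≤ n. Then there exists a covering configuration y whose cost equals OptCost and an index l* with r* := l* + λ − 1 ≤ n, such that: y_i = x_i for every i ∉ [l*, r*]; y_{t+1} = y_t + 2z for every t with l* ≤ t < r* (the λ sensors of the block are in attached positions); and either y_{l*} = z (the block's left endpoint is at 0) or y_{r*} = β − z (the block's right endpoint is at β). -/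

import Mathlib

/-- A configuration `y` of the `n` sensors (with covering range `z`) covers the
barrier `[0, β]`. -/
def Covers (n : ℕ) (z β : ℝ) (y : ℕ → ℝ) : Prop :=
  Set.Icc (0 : ℝ) β ⊆ ⋃ i ∈ Finset.Icc 1 n, Set.Icc (y i - z) (y i + z)

/-- The cost of moving the sensors from positions `x` to positions `y`. -/
noncomputable def Cost (n : ℕ) (x y : ℕ → ℝ) : ℝ :=
  ∑ i ∈ Finset.Icc 1 n, |x i - y i|

/-- The optimal (infimum) cost over all covering configurations. -/
noncomputable def OptCost (n : ℕ) (z β : ℝ) (x : ℕ → ℝ) : ℝ :=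
  sInf {c : ℝ | ∃ y : ℕ → ℝ, Covers n z β y ∧ c = Cost n x y}


theorem covers_iff {n : ℕ} {z β : ℝ} {y : ℕ → ℝ} :
    Covers n z β y ↔
      ∀ t, 0 ≤ t → t ≤ β → ∃ i, 1 ≤ i ∧ i ≤ n ∧ y i - z ≤ t ∧ t ≤ y i + z := by
  simp only [Covers, Set.subset_def, Set.mem_iUnion, Set.mem_Icc, Finset.mem_Icc, exists_prop,
    and_imp, and_assoc]

theorem le_of_le_succ_on {n : ℕ} {x : ℕ → ℝ}
    (hsort : ∀ i, 1 ≤ i → i < n → x i ≤ x (i + 1)) {i j : ℕ}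
    (hi : 1 ≤ i) (hij : i ≤ j) (hj : j ≤ n) : x i ≤ x j := by
  induction j, hij using Nat.le_induction with
  | base => exact le_rfl
  | succ j hij ih => exact (ih (by omega)).trans (hsort j (by omega) (by omega))

theorem sum_Icc_one_eq_sum_fin (n : ℕ) (f : ℕ → ℝ) :
    ∑ i ∈ Finset.Icc 1 n, f i = ∑ i : Fin n, f (i + 1) := by
  rw [Fin.sum_univ_eq_sum_range (fun i => f (i + 1)), Finset.range_eq_Ico,
    Finset.sum_Ico_add' f 0 n 1]
  rfl

/-- A sum over `1, …, n`, read outwards from the cut between `k` and `k + 1`. -/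
theorem sum_Icc_one_eq_sum_from_cut {n k : ℕ} (hk : k ≤ n) (f : ℕ → ℝ) :
    ∑ i ∈ Finset.Icc 1 n, f i =
      ∑ j ∈ Finset.range k, f (k - j) + ∑ j ∈ Finset.range (n - k), f (k + 1 + j) := by
  rw [sum_Icc_one_eq_sum_fin, Fin.sum_univ_eq_sum_range (fun i => f (i + 1))]
  obtain ⟨p, rfl⟩ := Nat.exists_eq_add_of_le hk
  rw [Finset.sum_range_add, Nat.add_sub_cancel_left, ← Finset.sum_range_reflect]
  congr 1
  · refine Finset.sum_congr rfl fun j hj => ?_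
    rw [Finset.mem_range] at hj
    congr 1
    omega
  · refine Finset.sum_congr rfl fun j _ => ?_
    congr 1
    omega

theorem abs_sub_add_abs_sub_le_of_crossing {a b c d : ℝ} (hab : a ≤ b) (hcd : c ≤ d) :
    |a - c| + |b - d| ≤ |a - d| + |b - c| := by
  rcases abs_cases (a - c) with h1 | h1 <;> rcases abs_cases (b - d) with h2 | h2 <;>
    rcases abs_cases (a - d) with h3 | h3 <;> rcases abs_cases (b - c) with h4 | h4 <;> linarith

/-- Sorting the final positions does not increase the total movement. -/
theorem sum_abs_sub_sort_le {n : ℕ} (x y : Fin n → ℝ) (hx : Monotone x) :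
    ∑ i, |x i - (y ∘ Tuple.sort y) i| ≤ ∑ i, |x i - y i| := by
  refine Tuple.bubble_sort_induction (f := y)
    (P := fun g => ∑ i, |x i - g i| ≤ ∑ i, |x i - y i|) le_rfl ?_
  intro g i j hij hlt hg
  refine le_trans ?_ hg
  have hne : i ≠ j := hij.ne
  have hj : j ∈ Finset.univ.erase i := by simp [hne.symm]
  rw [← Finset.add_sum_erase _ _ (Finset.mem_univ i), ← Finset.add_sum_erase _ _ hj,
    ← Finset.add_sum_erase _ (fun a => |x a - g a|) (Finset.mem_univ i),
    ← Finset.add_sum_erase _ (fun a => |x a - g a|) hj]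
  have hrest : ∑ a ∈ (Finset.univ.erase i).erase j, |x a - (g ∘ Equiv.swap i j) a| =
      ∑ a ∈ (Finset.univ.erase i).erase j, |x a - g a| := by
    refine Finset.sum_congr rfl fun a ha => ?_
    simp only [Finset.mem_erase] at ha
    rw [Function.comp_apply, Equiv.swap_apply_of_ne_of_ne ha.2.1 ha.1]
  rw [hrest]
  simp only [Function.comp_apply, Equiv.swap_apply_left, Equiv.swap_apply_right]
  have := abs_sub_add_abs_sub_le_of_crossing (hx hij.le) hlt.le
  linarith

theorem exists_sorted_covers {n : ℕ} {z β : ℝ} {x y : ℕ → ℝ}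
    (hsort : ∀ i, 1 ≤ i → i < n → x i ≤ x (i + 1)) (hy : Covers n z β y) :
    ∃ w : ℕ → ℝ, Covers n z β w ∧ (∀ i, 1 ≤ i → i < n → w i ≤ w (i + 1)) ∧
      Cost n x w ≤ Cost n x y := by
  set Y : Fin n → ℝ := fun i => y (i + 1) with hY
  set σ := Tuple.sort Y with hσ
  set w : ℕ → ℝ := fun i => if h : i - 1 < n then Y (σ ⟨i - 1, h⟩) else 0 with hw
  have hwfin : ∀ i : Fin n, w (i + 1) = Y (σ i) := fun i => by simp [hw]
  refine ⟨w, ?_, ?_, ?_⟩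
  · rw [covers_iff] at hy ⊢
    intro t h0 hβ
    obtain ⟨i, h1, hn, hl, hr⟩ := hy t h0 hβ
    set a : Fin n := σ.symm ⟨i - 1, by omega⟩ with ha
    have hwa : w (a + 1) = y i := by
      rw [hwfin, ha, Equiv.apply_symm_apply, hY]
      simp only
      congr 1
      omega
    exact ⟨a + 1, by omega, by omega, by rw [hwa]; exact hl, by rw [hwa]; exact hr⟩
  · intro i h1 hn
    have hm := Tuple.monotone_sort Y
      (show (⟨i - 1, by omega⟩ : Fin n) ≤ ⟨i, hn⟩ from Nat.sub_le i 1)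
    have e1 := hwfin ⟨i - 1, by omega⟩
    have e2 := hwfin ⟨i, hn⟩
    simp only [Nat.sub_add_cancel h1] at e1 e2
    rw [e1, e2]
    exact hm
  · unfold Cost
    rw [sum_Icc_one_eq_sum_fin, sum_Icc_one_eq_sum_fin]
    simp only [hwfin]
    refine sum_abs_sub_sort_le (fun i : Fin n => x (i + 1)) Y fun a b hab => ?_
    exact le_of_le_succ_on hsort (by omega) (by have : (a : ℕ) ≤ b := hab; omega) (by omega)

/-- The sensors of a sorted covering, clamped to `[-z, β + z]`, have no gap exceeding `2 * z`. -/
theorem clamp_succ_le_of_covers {n : ℕ} {z β : ℝ} {w : ℕ → ℝ} (hz : 0 < z) (hβ : 0 < β)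
    (hw : Covers n z β w) (hmono : ∀ i, 1 ≤ i → i < n → w i ≤ w (i + 1))
    {i : ℕ} (hi : 1 ≤ i) (hin : i < n) :
    max (-z) (min (w (i + 1)) (β + z)) ≤ max (-z) (min (w i) (β + z)) + 2 * z := by
  by_contra! hgap
  set a := max (-z) (min (w i) (β + z)) with ha
  set b := max (-z) (min (w (i + 1)) (β + z)) with hb
  have ha0 : -z ≤ a := le_max_left _ _
  have hb1 : b ≤ β + z := max_le (by linarith) (min_le_right _ _)
  have hwa : w i ≤ a := by
    rcases min_cases (w i) (β + z) with h | h
    · exact h.1 ▸ le_max_right _ _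
    · have : min (w i) (β + z) ≤ a := le_max_right _ _
      linarith
  have hwb : b ≤ w (i + 1) := by
    rcases max_cases (-z) (min (w (i + 1)) (β + z)) with h | h
    · linarith
    · rw [hb, h.1]; exact min_le_left _ _
  rw [covers_iff] at hw
  obtain ⟨j, hj1, hjn, hl, hr⟩ := hw ((a + b) / 2) (by linarith) (by linarith)
  rcases Nat.lt_or_ge i j with h | h
  · have := le_of_le_succ_on hmono (show 1 ≤ i + 1 by omega) h hjn
    linarith
  · have := le_of_le_succ_on hmono hj1 h hin.le
    linarith

/-- A nonnegative sequence with steps down of at most `d` and last term at most `d` has an initial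
run of positive terms long enough to bound its first term. -/
theorem exists_pos_run {N : ℕ} (hN : 1 ≤ N) {d : ℝ} {u : ℕ → ℝ}
    (hstep : ∀ j, j + 1 < N → u j ≤ u (j + 1) + d) (hlast : u (N - 1) ≤ d) :
    (∀ j < N, u 0 ≤ u j + d * j) ∧ ∃ m ≤ N, (∀ j < m, 0 < u j) ∧ u 0 ≤ d * m := by
  have hchain : ∀ j < N, u 0 ≤ u j + d * j := by
    intro j hj
    induction j with
    | zero => simp
    | succ j ih =>
      have := ih (by omega)
      have := hstep j hj
      push_cast
      linarith
  refine ⟨hchain, ?_⟩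
  by_cases hall : ∀ j < N, 0 < u j
  · refine ⟨N, le_rfl, hall, ?_⟩
    have := hchain (N - 1) (by omega)
    rw [Nat.cast_sub hN] at this
    push_cast at this
    linarith
  · push Not at hall
    classical
    refine ⟨Nat.find hall, (Nat.find_spec hall).1.le, ?_, ?_⟩
    · intro j hj
      have := Nat.find_min hall hj
      push Not at this
      exact this (hj.trans (Nat.find_spec hall).1)
    · have := hchain _ (Nat.find_spec hall).1
      linarith [(Nat.find_spec hall).2]

/-- Signed cost of moving the last `m` sensors up to `k` to `s, s - 2 * z, …` and the first `p`
sensors after `k` to `t, t + 2 * z, …`. -/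
noncomputable def attachedCost (z : ℝ) (x : ℕ → ℝ) (k m p : ℕ) (s t : ℝ) : ℝ :=
  ∑ j ∈ Finset.range m, (s - 2 * z * j - x (k - j)) +
    ∑ j ∈ Finset.range p, (x (k + 1 + j) - (t + 2 * z * j))

theorem attachedCost_eq_add (z : ℝ) (x : ℕ → ℝ) (k m p : ℕ) (s t s' t' : ℝ) :
    attachedCost z x k m p s t =
      attachedCost z x k m p s' t' + m * (s - s') - p * (t - t') := by
  simp only [attachedCost, Finset.sum_sub_distrib, Finset.sum_add_distrib, Finset.sum_const,
    Finset.card_range, nsmul_eq_mul]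
  ring

theorem attachedCost_succ_left (z : ℝ) (x : ℕ → ℝ) (k m p : ℕ) (s t : ℝ) :
    attachedCost z x k (m + 1) p s t =
      attachedCost z x k m p s t + (s - 2 * z * m - x (k - m)) := by
  simp only [attachedCost, Finset.sum_range_succ]
  ring

theorem exists_attachedCost_le {n k : ℕ} {z β : ℝ} {x y : ℕ → ℝ} (hz : 0 < z) (hβ : 0 < β)
    (hsort : ∀ i, 1 ≤ i → i < n → x i ≤ x (i + 1)) (hk1 : 1 ≤ k) (hkn : k < n)
    (hy : Covers n z β y) :
    ∃ (m p : ℕ) (s t : ℝ), m ≤ k ∧ p ≤ n - k ∧ s ≤ 2 * z * m - z ∧ β + z - 2 * z * p ≤ t ∧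
      t ≤ s + 2 * z ∧
      ∀ m' ≤ m, ∀ p' ≤ p, attachedCost z x k m' p' s t ≤ Cost n x y := by
  obtain ⟨w, hw, hmono, hcost⟩ := exists_sorted_covers hsort hy
  set v : ℕ → ℝ := fun i => max (-z) (min (w i) (β + z)) with hv
  have hgap : ∀ i, 1 ≤ i → i < n → v (i + 1) ≤ v i + 2 * z := fun i h1 h2 =>
    clamp_succ_le_of_covers hz hβ hw hmono h1 h2
  have hfirst : v 1 ≤ z := by
    obtain ⟨i, h1, hn, hl, -⟩ := covers_iff.1 hw 0 le_rfl hβ.le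
    have := le_of_le_succ_on hmono le_rfl h1 hn
    exact max_le (by linarith) ((min_le_left _ _).trans (by linarith))
  have hlast : β - z ≤ v n := by
    obtain ⟨i, h1, hn, -, hr⟩ := covers_iff.1 hw β hβ.le le_rfl
    have := le_of_le_succ_on hmono h1 hn le_rfl
    exact le_max_of_le_right (le_min (by linarith) (by linarith))
  obtain ⟨hL, m, hmk, hmpos, hms⟩ := exists_pos_run (N := k) hk1 (d := 2 * z)
    (u := fun j => v (k - j) + z)
    (fun j hj => by
      have := hgap (k - (j + 1)) (by omega) (by omega)
      rw [show k - (j + 1) + 1 = k - j by omega] at this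
      linarith)
    (by simp only [show k - (k - 1) = 1 by omega]; linarith)
  obtain ⟨hR, p, hpk, hppos, hpt⟩ := exists_pos_run (N := n - k) (by omega) (d := 2 * z)
    (u := fun j => β + z - v (k + 1 + j))
    (fun j hj => by
      have := hgap (k + 1 + j) (by omega) (by omega)
      rw [show k + 1 + j + 1 = k + 1 + (j + 1) by omega] at this
      linarith)
    (by simp only [show k + 1 + (n - k - 1) = n by omega]; linarith)
  simp only [Nat.sub_zero, Nat.add_zero] at hL hms hR hpt
  refine ⟨m, p, v k, v (k + 1), hmk, hpk, by linarith, by linarith, hgap k hk1 hkn, ?_⟩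
  intro m' hm' p' hp'
  refine le_trans ?_ hcost
  rw [Cost, sum_Icc_one_eq_sum_from_cut hkn.le, attachedCost]
  refine add_le_add ?_ ?_
  · refine (Finset.sum_le_sum fun j hj => ?_).trans
      (Finset.sum_le_sum_of_subset_of_nonneg
        (Finset.range_subset_range.2 (hm'.trans hmk)) fun _ _ _ => abs_nonneg _)
    rw [Finset.mem_range] at hj
    have h1 := hmpos j (by omega)
    have h2 := hL j (by omega)
    have h3 : v (k - j) ≤ w (k - j) := by
      simp only [hv] at h1 ⊢
      rcases max_cases (-z) (min (w (k - j)) (β + z)) with h | h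
      · linarith
      · rw [h.1]; exact min_le_left _ _
    have := neg_abs_le (x (k - j) - w (k - j))
    linarith
  · refine (Finset.sum_le_sum fun j hj => ?_).trans
      (Finset.sum_le_sum_of_subset_of_nonneg
        (Finset.range_subset_range.2 (hp'.trans hpk)) fun _ _ _ => abs_nonneg _)
    rw [Finset.mem_range] at hj
    have h1 := hppos j (by omega)
    have h2 := hR j (by omega)
    have h3 : w (k + 1 + j) ≤ v (k + 1 + j) := by
      have h4 : min (w (k + 1 + j)) (β + z) ≤ v (k + 1 + j) := le_max_right _ _
      rcases min_cases (w (k + 1 + j)) (β + z) with h | h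
      · linarith
      · linarith
    have := le_abs_self (x (k + 1 + j) - w (k + 1 + j))
    linarith

/-- Position of the `k`-th sensor when `m` sensors up to `k` and `p` sensors after `k` form an
attached block with left end at `0` (`left = true`) or right end at `β` (`left = false`). -/
noncomputable def alignedPos (z β : ℝ) (m p : ℕ) (left : Bool) : ℝ :=
  if left then 2 * z * m - z else β - z - 2 * z * p

/-- Cost of an aligned attached block. -/
noncomputable def alignedCost (z β : ℝ) (x : ℕ → ℝ) (k m p : ℕ) (left : Bool) : ℝ :=
  attachedCost z x k m p (alignedPos z β m p left) (alignedPos z β m p left + 2 * z)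

theorem exists_alignedCost_le {n k L : ℕ} {z β : ℝ} {x y : ℕ → ℝ} (hz : 0 < z) (hβ : 0 < β)
    (hsort : ∀ i, 1 ≤ i → i < n → x i ≤ x (i + 1)) (hk1 : 1 ≤ k) (hkn : k < n)
    (hkleft : x k + z < 0) (hL : ∀ N : ℕ, β ≤ 2 * z * N → L ≤ N)
    (hy : Covers n z β y) :
    ∃ (m p : ℕ) (left : Bool), m ≤ k ∧ p ≤ n - k ∧ m + p = L ∧
      alignedCost z β x k m p left ≤ Cost n x y := by
  obtain ⟨m, p, s, t, hmk, hpk, hs, ht, hts, hle⟩ :=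
    exists_attachedCost_le hz hβ hsort hk1 hkn hy
  have hmp : L ≤ m + p := hL _ (by push_cast; linarith)
  rcases Nat.lt_or_ge L (2 * p) with hp | hp
  · rcases Nat.lt_or_ge L (2 * m) with hm | hm
    · obtain ⟨q, rfl | rfl⟩ := Nat.even_or_odd' L
      · refine ⟨q, q, true, by omega, by omega, by omega, ?_⟩
        refine le_trans ?_ (hle q (by omega) q (by omega))
        rw [alignedCost, attachedCost_eq_add z x k q q s t
          (alignedPos z β q q true) (alignedPos z β q q true + 2 * z)]
        have : 0 ≤ (q : ℝ) * (s + 2 * z - t) := mul_nonneg q.cast_nonneg (by linarith)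
        linarith
      · refine ⟨q, q + 1, true, by omega, by omega, by omega, ?_⟩
        refine le_trans ?_ (hle (q + 1) (by omega) (q + 1) (by omega))
        have hx : x (k - q) ≤ x k :=
          le_of_le_succ_on hsort (by omega) (by omega) hkn.le
        rw [alignedCost, attachedCost_eq_add z x k (q + 1) (q + 1) s t
          (alignedPos z β q (q + 1) true) (alignedPos z β q (q + 1) true + 2 * z),
          attachedCost_succ_left]
        simp only [alignedPos, if_true]
        have : 0 ≤ ((q + 1 : ℕ) : ℝ) * (s + 2 * z - t) :=
          mul_nonneg (Nat.cast_nonneg _) (by linarith)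
        linarith
    · obtain ⟨p', rfl⟩ : ∃ p', L = m + p' := ⟨L - m, by omega⟩
      refine ⟨m, p', true, by omega, by omega, rfl, ?_⟩
      refine le_trans ?_ (hle m le_rfl p' (by omega))
      rw [alignedCost, attachedCost_eq_add z x k m p' s t
          (alignedPos z β m p' true) (alignedPos z β m p' true + 2 * z)]
      simp only [alignedPos, if_true]
      have hc : (m : ℝ) ≤ p' := by exact_mod_cast (by omega : m ≤ p')
      have h1 : 0 ≤ ((p' : ℝ) - m) * (2 * z * m - z - s) :=
        mul_nonneg (by linarith) (by linarith)
      have h2 : 0 ≤ (p' : ℝ) * (s + 2 * z - t) := mul_nonneg p'.cast_nonneg (by linarith)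
      linarith
  · obtain ⟨m', rfl⟩ : ∃ m', L = m' + p := ⟨L - p, by omega⟩
    refine ⟨m', p, false, by omega, by omega, rfl, ?_⟩
    refine le_trans ?_ (hle m' (by omega) p le_rfl)
    rw [alignedCost, attachedCost_eq_add z x k m' p s t
        (alignedPos z β m' p false) (alignedPos z β m' p false + 2 * z)]
    simp only [alignedPos, Bool.false_eq_true, if_false]
    have hc : (p : ℝ) ≤ m' := by exact_mod_cast (by omega : p ≤ m')
    have h1 : 0 ≤ ((m' : ℝ) - p) * (t - (β + z - 2 * z * p)) :=
      mul_nonneg (by linarith) (by linarith)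
    have h2 : 0 ≤ (m' : ℝ) * (s + 2 * z - t) := mul_nonneg m'.cast_nonneg (by linarith)
    linarith

theorem exists_attached_interval_mem {a d t : ℝ} {N : ℕ} (hN : 1 ≤ N) (ha : a ≤ t)
    (ht : t ≤ a + d * N) : ∃ j < N, a + d * j ≤ t ∧ t ≤ a + d * (j + 1) := by
  induction N, hN using Nat.le_induction with
  | base => exact ⟨0, one_pos, by simpa using ha, by simpa using ht⟩
  | succ N hN ih =>
    rcases le_total t (a + d * N) with h | h
    · obtain ⟨j, hj, hjt⟩ := ih h
      exact ⟨j, by omega, hjt⟩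
    · exact ⟨N, by omega, h, by push_cast at ht; exact ht⟩

/-- The configuration in which the sensors `k + 1 - m, …, k + p` form an attached block with the
`k`-th position at `s`, the others staying in place. -/
noncomputable def blockConfig (z : ℝ) (x : ℕ → ℝ) (k m p : ℕ) (s : ℝ) (i : ℕ) : ℝ :=
  if k < i + m ∧ i ≤ k + p then s + 2 * z * ((i : ℝ) - k) else x i

theorem blockConfig_covers {n k m p : ℕ} {z β : ℝ} (x : ℕ → ℝ) {s : ℝ}
    (hmk : m ≤ k) (hpn : p ≤ n - k) (hkn : k < n) (hmp : 1 ≤ m + p)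
    (hl : s + 2 * z * (1 - m) ≤ z) (hr : β - z ≤ s + 2 * z * p) :
    Covers n z β (blockConfig z x k m p s) := by
  rw [covers_iff]
  intro t h0 hβ
  obtain ⟨j, hj, hjl, hjr⟩ := exists_attached_interval_mem (a := s + 2 * z * (1 - m) - z)
    (d := 2 * z) (t := t) hmp (by linarith) (by push_cast; linarith)
  refine ⟨k + 1 + j - m, by omega, by omega, ?_⟩
  rw [blockConfig, if_pos (by omega), Nat.cast_sub (by omega)]
  push_cast
  constructor <;> linarith

theorem cost_blockConfig {n k m p : ℕ} {z β : ℝ} {x : ℕ → ℝ} {s : ℝ} (hz : 0 < z)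
    (hsort : ∀ i, 1 ≤ i → i < n → x i ≤ x (i + 1)) (hkn : k < n)
    (hkleft : x k + z < 0) (hkright : β + z < x (k + 1)) (hmk : m ≤ k) (hpn : p ≤ n - k)
    (hl : -z ≤ s + 2 * z * (1 - m)) (hr : s + 2 * z * p ≤ β + z) :
    Cost n x (blockConfig z x k m p s) = attachedCost z x k m p s (s + 2 * z) := by
  rw [Cost, sum_Icc_one_eq_sum_from_cut hkn.le, attachedCost]
  congr 1
  · rw [← Finset.sum_subset (Finset.range_subset_range.2 hmk)]
    · refine Finset.sum_congr rfl fun j hj => ?_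
      rw [Finset.mem_range] at hj
      have hx : x (k - j) ≤ x k := le_of_le_succ_on hsort (by omega) (by omega) hkn.le
      have hjm : (j : ℝ) + 1 ≤ m := by exact_mod_cast hj
      have : 0 ≤ 2 * z * ((m : ℝ) - (j + 1)) := mul_nonneg (by linarith) (by linarith)
      rw [blockConfig, if_pos (by omega), Nat.cast_sub (by omega), abs_of_nonpos (by linarith)]
      ring
    · intro j hj hjm
      rw [Finset.mem_range] at hj hjm
      rw [blockConfig, if_neg (by omega), sub_self, abs_zero]
  · rw [← Finset.sum_subset (Finset.range_subset_range.2 hpn)]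
    · refine Finset.sum_congr rfl fun j hj => ?_
      rw [Finset.mem_range] at hj
      have hx : x (k + 1) ≤ x (k + 1 + j) :=
        le_of_le_succ_on hsort (by omega) (by omega) (by omega)
      have hjm : (j : ℝ) + 1 ≤ p := by exact_mod_cast hj
      have : 0 ≤ 2 * z * ((p : ℝ) - (j + 1)) := mul_nonneg (by linarith) (by linarith)
      rw [blockConfig, if_pos (by omega)]
      push_cast
      rw [abs_of_nonneg (by linarith)]
      ring
    · intro j hj hjm
      rw [Finset.mem_range] at hj hjm
      rw [blockConfig, if_neg (by omega), sub_self, abs_zero]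

/-- Lemma 18 (structural content): if no sensor interval intersects the barrier
(sensors `1..k` strictly to the left, sensors `k+1..n` strictly to the right) and
`λ = ⌈β/(2z)⌉ ≤ n`, then some optimal covering configuration moves exactly one block
of `λ` consecutive sensors into attached positions, with the block's left endpoint at
`0` or its right endpoint at `β`, and leaves all other sensors unmoved. -/
theorem no_intersection_optimal_structure
    (n : ℕ) (z β : ℝ) (x : ℕ → ℝ) (k : ℕ)
    (hn : 1 ≤ n) (hz : 0 < z) (hβ : 0 < β)
    (hsort : ∀ i, 1 ≤ i → i < n → x i ≤ x (i + 1))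
    (hk1 : 1 ≤ k) (hkn : k < n)
    (hkleft : x k + z < 0) (hkright : β + z < x (k + 1))
    (hlam : ⌈β / (2 * z)⌉₊ ≤ n) :
    ∃ (y : ℕ → ℝ) (lstar rstar : ℕ),
      rstar = lstar + ⌈β / (2 * z)⌉₊ - 1 ∧
      1 ≤ lstar ∧ rstar ≤ n ∧
      Covers n z β y ∧
      Cost n x y = OptCost n z β x ∧
      (∀ i, 1 ≤ i → i ≤ n → (i < lstar ∨ rstar < i) → y i = x i) ∧
      (∀ t, lstar ≤ t → t < rstar → y (t + 1) = y t + 2 * z) ∧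
      (y lstar = z ∨ y rstar = β - z) := by
  have hpos : 0 < β / (2 * z) := by positivity
  have hL1 : 1 ≤ ⌈β / (2 * z)⌉₊ := Nat.ceil_pos.2 hpos
  have hLle : β ≤ 2 * z * ⌈β / (2 * z)⌉₊ := by
    have := Nat.le_ceil (β / (2 * z))
    rw [div_le_iff₀ (by positivity)] at this
    linarith
  have hLlt : 2 * z * ⌈β / (2 * z)⌉₊ < β + 2 * z := by
    have := Nat.ceil_lt_add_one hpos.le
    rw [← sub_lt_iff_lt_add, lt_div_iff₀ (by positivity)] at this
    linarith
  have hLmin : ∀ N : ℕ, β ≤ 2 * z * N → ⌈β / (2 * z)⌉₊ ≤ N := fun N hN =>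
    Nat.ceil_le.2 ((div_le_iff₀ (by positivity)).2 (by linarith))
  generalize ⌈β / (2 * z)⌉₊ = L at *
  let S : Finset (ℕ × Bool) :=
    (Finset.range (L + 1) ×ˢ Finset.univ).filter fun c => c.1 ≤ k ∧ L - c.1 ≤ n - k
  have hS : S.Nonempty :=
    ⟨(min k L, true), by simp [S]; omega⟩
  obtain ⟨⟨m, b⟩, hmem, hmin⟩ :=
    S.exists_min_image (fun c => alignedCost z β x k c.1 (L - c.1) c.2) hS
  obtain ⟨p, rfl⟩ : ∃ p, L = m + p := ⟨L - m, by simp [S] at hmem; omega⟩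
  have hmk : m ≤ k := by simp [S] at hmem; omega
  have hpn : p ≤ n - k := by simp [S] at hmem; omega
  simp only [Nat.add_sub_cancel_left] at hmin
  push_cast at hLle hLlt
  set s := alignedPos z β m p b with hs
  have hs_cases : s = 2 * z * m - z ∨ s = β - z - 2 * z * p := by
    cases b <;> simp [hs, alignedPos]
  have hcov : Covers n z β (blockConfig z x k m p s) :=
    blockConfig_covers x hmk hpn hkn hL1
      (by rcases hs_cases with h | h <;> rw [h] <;> linarith)
      (by rcases hs_cases with h | h <;> rw [h] <;> linarith)
  have hcost : Cost n x (blockConfig z x k m p s) = alignedCost z β x k m p b :=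
    cost_blockConfig hz hsort hkn hkleft hkright hmk hpn
      (by rcases hs_cases with h | h <;> rw [h] <;> linarith)
      (by rcases hs_cases with h | h <;> rw [h] <;> linarith)
  have hleast : IsLeast {c : ℝ | ∃ y : ℕ → ℝ, Covers n z β y ∧ c = Cost n x y}
      (Cost n x (blockConfig z x k m p s)) := by
    refine ⟨⟨_, hcov, rfl⟩, ?_⟩
    rintro _ ⟨y, hy, rfl⟩
    obtain ⟨m', p', b', hm', hp', hsum, hle⟩ :=
      exists_alignedCost_le hz hβ hsort hk1 hkn hkleft hLmin hy
    have := hmin (m', b') (by simp [S]; omega)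
    rw [hcost]
    refine this.trans ?_
    rwa [show m + p - m' = p' by omega]
  refine ⟨blockConfig z x k m p s, k + 1 - m, k + p, by omega, by omega, by omega, hcov,
    hleast.csInf_eq.symm, ?_, ?_, ?_⟩
  · intro i _ _ hi
    rw [blockConfig, if_neg (by omega)]
  · intro t hl hr
    rw [blockConfig, blockConfig, if_pos (by omega), if_pos (by omega)]
    push_cast
    ring
  · rcases hs_cases with h | h
    · left
      rw [blockConfig, if_pos (by omega), h, Nat.cast_sub (by omega)]
      push_cast
      ring
    · right
      rw [blockConfig, if_pos (by omega), h]
      push_cast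
      ring
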